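/- There exists an absolute constant C > 0 such that the following holds. Let 0 < δ < 1/16, let f ∈ L²(ℝ²) be supported in the ball B(0,δ), and let α, β be any angles. If h ∈ L²(ℝ²) is the function whose Fourier transform satisfies 𝓕h = 𝟙_{S(α,β)}·𝓕f almost everywhere, where S(α,β) = Γ_β \ Γ_α, then ‖ h·𝟙_{{x : ‖x‖ ≥ 1/2}} ‖_{L²(ℝ²)} ≤ C·δ^{1/4}·‖f‖_{L²(ℝ²)}. -/

import Mathlib

open MeasureTheory Real FourierTransform

/-- The Euclidean plane `ℝ²`. -/
noncomputable abbrev Plane := EuclideanSpace ℝ (Fin 2)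

/-- The sector `S(α,β) = Γ_β \ Γ_α = {x : x₁cos β + x₂sin β ≥ 0, x₁cos α + x₂sin α < 0}`. -/
def sector (α β : ℝ) : Set Plane :=
  {x | 0 ≤ x 0 * Real.cos β + x 1 * Real.sin β ∧ x 0 * Real.cos α + x 1 * Real.sin α < 0}

/-- The `L²(ℝ²)` norm. -/
noncomputable def l2norm2 {E : Type*} [NormedAddCommGroup E] (f : Plane → E) : ℝ :=
  (∫ x : Plane, ‖f x‖ ^ 2) ^ ((1:ℝ)/2)

/-- `HasFourierTransform h u` says that the (distributional/L²) Fourier transform of `h` is `u`,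
expressed through the multiplication formula `∫ h ⬝ 𝓕φ = ∫ u ⬝ φ` against Schwartz functions. -/
def HasFourierTransform (h u : Plane → ℂ) : Prop :=
  ∀ φ : SchwartzMap Plane ℂ,
    ∫ x : Plane, h x * 𝓕 (fun y => φ y) x = ∫ ξ : Plane, u ξ * φ ξ


lemma planch_aux (G w : Plane → ℂ) (hG : MemLp G 2 (volume : Measure Plane))
    (hw : LocallyIntegrable w (volume : Measure Plane)) (H : HasFourierTransform G w) :
    MemLp w 2 (volume : Measure Plane) ∧ ∫ x, ‖w x‖ ^ 2 = ∫ x, ‖G x‖ ^ 2 := by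
  set g : Lp (α := Plane) ℂ 2 (volume : Measure Plane) := hG.toLp G with hg
  set k : Lp (α := Plane) ℂ 2 (volume : Measure Plane) := 𝓕 g with hk
  have h1 : 𝓕 (Lp.toTemperedDistribution g) = Lp.toTemperedDistribution (𝓕 g) :=
    Lp.fourier_toTemperedDistribution_eq g
  have hkm : MemLp k 2 (volume : Measure Plane) := Lp.memLp k
  have key : ∀ φ : SchwartzMap Plane ℂ, ∫ x, φ x * k x = ∫ x, φ x * w x := by
    intro φ
    have h2 := congrArg (fun T => T φ) h1
    simp only [TemperedDistribution.fourier_apply, Lp.toTemperedDistribution_apply, smul_eq_mul] at h2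
    rw [hk, ← h2]
    have h3 := H φ
    simp only [mul_comm (φ _)]
    rw [← h3]
    apply integral_congr_ae
    filter_upwards [hG.coeFn_toLp] with x hx
    rw [hg, hx, mul_comm, SchwartzMap.fourier_coe]
  have hae : ∀ᵐ x ∂(volume : Measure Plane), k x = w x := by
    apply ae_eq_of_integral_contDiff_smul_eq (hkm.locallyIntegrable (by norm_num)) hw
    intro φ hφ hc
    have hc' : HasCompactSupport (fun x => (φ x : ℂ)) := hc.comp_left (g := fun r : ℝ => (r : ℂ)) (by simp)
    have := key (hc'.toSchwartzMap (Complex.ofRealCLM.contDiff.comp hφ))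
    simp only [Complex.real_smul]
    exact this
  refine ⟨hkm.ae_eq hae, ?_⟩
  have e1 : ∫ x, ‖w x‖ ^ 2 = ‖k‖ ^ 2 := by
    have : ∫ x, ‖w x‖ ^ 2 = ∫ x, ‖k x‖ ^ 2 :=
      integral_congr_ae (hae.mono fun x hx => by simp only [hx])
    rw [this, ← real_inner_self_eq_norm_sq, L2.inner_def (𝕜 := ℝ)]
    simp
  have e2 : ∫ x, ‖G x‖ ^ 2 = ‖g‖ ^ 2 := by
    have : ∫ x, ‖G x‖ ^ 2 = ∫ x, ‖g x‖ ^ 2 :=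
      integral_congr_ae (hG.coeFn_toLp.mono fun x hx => by simp only [hg, hx])
    rw [this, ← real_inner_self_eq_norm_sq, L2.inner_def (𝕜 := ℝ)]
    simp
  rw [e1, e2, hk, Lp.norm_fourier_eq]

/-- The character. -/
noncomputable def chr (v x : Plane) : ℂ := ((Real.fourierChar (inner ℝ x v) : Circle) : ℂ)

lemma norm_chr (v x : Plane) : ‖chr v x‖ = 1 := Circle.norm_coe _

lemma continuous_chr (v : Plane) : Continuous (chr v) := by
  unfold chr
  exact continuous_subtype_val.comp (Real.continuous_fourierChar.comp (by fun_prop))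

lemma norm_chr_sub_one (v x : Plane) :
    ‖chr v x - 1‖ ^ 2 = 2 - 2 * Real.cos (2 * π * inner ℝ x v) := by
  rw [chr, Real.fourierChar_apply, ← Complex.normSq_eq_norm_sq, Complex.exp_mul_I, Complex.normSq_apply,
    ← Complex.ofReal_cos, ← Complex.ofReal_sin]
  simp only [Complex.sub_re, Complex.add_re, Complex.mul_re, Complex.ofReal_re, Complex.ofReal_im,
    Complex.I_re, Complex.I_im, Complex.one_re, Complex.sub_im, Complex.add_im, Complex.mul_im,
    Complex.one_im]
  nlinarith [Real.sin_sq_add_cos_sq (2 * π * inner ℝ x v)]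

lemma memLp_chr_mul (v : Plane) {G : Plane → ℂ} (hG : MemLp G 2 (volume : Measure Plane)) :
    MemLp (fun x => chr v x * G x) 2 (volume : Measure Plane) := by
  refine hG.of_le ((continuous_chr v).aestronglyMeasurable.mul hG.1) ?_
  filter_upwards with x
  simp [norm_chr]

lemma shift_FT (v : Plane) {G w : Plane → ℂ} (H : HasFourierTransform G w) :
    HasFourierTransform (fun x => chr v x * G x) (fun ξ => w (ξ - v)) := by
  intro φ
  have h1 := H (φ.compSubConstCLM ℂ (-v))
  have e : ∀ x, 𝓕 (fun y => (φ.compSubConstCLM ℂ (-v)) y) x = chr v x * 𝓕 (fun y => φ y) x := by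
    intro x
    rw [Real.fourier_eq, Real.fourier_eq, ← integral_const_mul]
    rw [← integral_sub_right_eq_self _ v]
    congr 1
    ext y
    simp only [SchwartzMap.compSubConstCLM_apply, sub_neg_eq_add, sub_add_cancel, chr,
      Circle.smul_def, smul_eq_mul, ← mul_assoc]
    congr 1
    rw [← Circle.coe_mul, ← AddChar.map_add_eq_mul, inner_sub_left, real_inner_comm v x]
    congr 3
    ring
  simp only [e] at h1
  have e2 : ∫ ξ, w (ξ - v) * φ ξ = ∫ ξ, w ξ * (φ.compSubConstCLM ℂ (-v)) ξ := by
    rw [← integral_sub_right_eq_self (fun ξ => w ξ * (φ.compSubConstCLM ℂ (-v)) ξ) v]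
    simp
  rw [e2, ← h1]
  congr 1
  ext x
  ring

lemma memLp_shift (v : Plane) {w : Plane → ℂ} (hw : MemLp w 2 (volume : Measure Plane)) :
    MemLp (fun x => w (x - v)) 2 (volume : Measure Plane) :=
  hw.comp_measurePreserving (measurePreserving_sub_right volume v)

lemma diff_planch (v : Plane) {G w : Plane → ℂ} (hG : MemLp G 2 (volume : Measure Plane))
    (hw : MemLp w 2 (volume : Measure Plane)) (H : HasFourierTransform G w) :
    ∫ ξ, ‖w (ξ - v) - w ξ‖ ^ 2 = ∫ x, ‖chr v x - 1‖ ^ 2 * ‖G x‖ ^ 2 := by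
  have hD : MemLp (fun x => chr v x * G x - G x) 2 (volume : Measure Plane) :=
    (memLp_chr_mul v hG).sub hG
  have hW : MemLp (fun x => w (x - v) - w x) 2 (volume : Measure Plane) :=
    (memLp_shift v hw).sub hw
  have HD : HasFourierTransform (fun x => chr v x * G x - G x) (fun x => w (x - v) - w x) := by
    intro φ
    have hφ : MemLp (fun x => φ x) 2 (volume : Measure Plane) := φ.memLp 2
    have hFφ : MemLp (𝓕 (fun x => φ x)) 2 (volume : Measure Plane) := by
      have := (𝓕 φ).memLp 2 (volume : Measure Plane)
      rwa [SchwartzMap.fourier_coe] at this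
    simp only [sub_mul]
    rw [integral_sub, integral_sub, H φ, shift_FT v H φ]
    · exact (memLp_shift v hw).integrable_mul hφ
    · exact hw.integrable_mul hφ
    · exact (memLp_chr_mul v hG).integrable_mul hFφ
    · exact hG.integrable_mul hFφ
  rw [(planch_aux _ _ hD (hW.locallyIntegrable (by norm_num)) HD).2]
  congr 1
  ext x
  rw [← mul_pow, ← norm_mul, sub_mul, one_mul]

lemma FT_of_integrable {f : Plane → ℂ} (hf : Integrable f (volume : Measure Plane)) :
    HasFourierTransform f (𝓕 f) := by
  intro φ
  have := VectorFourier.integral_fourierIntegral_smul_eq_flip (L := innerₗ Plane)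
      Real.continuous_fourierChar continuous_inner hf (φ.integrable (μ := volume))
  simp only [flip_innerₗ, smul_eq_mul] at this
  exact this.symm

lemma memLp_FT {f : Plane → ℂ} (hf : Integrable f (volume : Measure Plane))
    (hf2 : MemLp f 2 (volume : Measure Plane)) :
    MemLp (𝓕 f) 2 (volume : Measure Plane) ∧ ∫ x, ‖𝓕 f x‖ ^ 2 = ∫ x, ‖f x‖ ^ 2 := by
  have hc : Continuous (𝓕 f) := VectorFourier.fourierIntegral_continuous (L := innerₗ Plane)
      Real.continuous_fourierChar continuous_inner hf
  exact planch_aux f _ hf2 hc.locallyIntegrable (FT_of_integrable hf)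

lemma shift_bound {δ : ℝ} (v : Plane) {f : Plane → ℂ} (hδ : 0 < δ)
    (hf1 : Integrable f (volume : Measure Plane))
    (hf : MemLp f 2 (volume : Measure Plane)) (hs : Function.support f ⊆ Metric.ball (0 : Plane) δ) :
    ∫ ξ, ‖𝓕 f (ξ - v) - 𝓕 f ξ‖ ^ 2 ≤ (2 * π * ‖v‖ * δ) ^ 2 * ∫ x, ‖f x‖ ^ 2 := by
  rw [diff_planch v hf (memLp_FT hf1 hf).1 (FT_of_integrable hf1), ← integral_const_mul]
  apply integral_mono_of_nonneg
  · filter_upwards with x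
    positivity
  · exact (hf.integrable_norm_pow two_ne_zero).const_mul _
  · filter_upwards with x
    by_cases hx : f x = 0
    · simp [hx]
    · have hx' : ‖x‖ < δ := by simpa using hs hx
      apply mul_le_mul_of_nonneg_right _ (by positivity)
      rw [norm_chr_sub_one]
      have h1 := Real.one_sub_sq_div_two_le_cos (x := 2 * π * inner ℝ x v)
      have h2 : |2 * π * inner ℝ x v| ≤ 2 * π * ‖v‖ * δ := by
        rw [abs_mul, abs_of_pos (by positivity : (0:ℝ) < 2 * π), mul_assoc (2 * π)]
        apply mul_le_mul_of_nonneg_left _ (by positivity)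
        calc |inner ℝ x v| ≤ ‖x‖ * ‖v‖ := abs_real_inner_le_norm x v
          _ ≤ δ * ‖v‖ := by gcongr
          _ = ‖v‖ * δ := mul_comm _ _
      have h3 := sq_le_sq' (abs_le.mp h2).1 (abs_le.mp h2).2
      linarith

/-- Parallel strips. -/
def strip (e : Plane) (k : ℕ) : Set Plane :=
  {ξ | 10 * (k : ℝ) - 5 ≤ inner ℝ ξ e ∧ inner ℝ ξ e < 10 * (k : ℝ) + 5}

lemma measurableSet_strip (e : Plane) (k : ℕ) : MeasurableSet (strip e k) := by
  have hm : Measurable (fun ξ : Plane => (inner ℝ ξ e : ℝ)) :=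
    Continuous.measurable (by fun_prop)
  exact (measurableSet_le measurable_const hm).inter (measurableSet_lt hm measurable_const)

lemma strip_disjoint (e : Plane) : Pairwise (Function.onFun Disjoint (strip e)) := by
  intro i j hij
  refine Set.disjoint_left.mpr ?_
  rintro ξ ⟨h1, h2⟩ ⟨h3, h4⟩
  rcases lt_or_gt_of_ne hij with h | h
  · have : (i : ℝ) + 1 ≤ j := by exact_mod_cast h
    linarith
  · have : (j : ℝ) + 1 ≤ i := by exact_mod_cast h
    linarith

lemma strip_shift (e : Plane) (he : ‖e‖ = 1) (k : ℕ) {F : Plane → ℂ} 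
    (hF : MemLp F 2 (volume : Measure Plane)) :
    ∫ ξ in strip e 0, ‖F ξ‖ ^ 2 ≤ 2 * (∫ ξ in strip e k, ‖F ξ‖ ^ 2) +
      2 * ∫ ξ, ‖F (ξ - (-(10 * (k:ℝ))) • e) - F ξ‖ ^ 2 := by
  set v : Plane := (-(10 * (k:ℝ))) • e with hv
  have hFv := memLp_shift v hF
  have i1 : Integrable (fun ξ => ‖F ξ‖ ^ 2) (volume : Measure Plane) :=
    hF.integrable_norm_pow two_ne_zero
  have i2 : Integrable (fun ξ => ‖F (ξ - v)‖ ^ 2) (volume : Measure Plane) :=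
    hFv.integrable_norm_pow two_ne_zero
  have i3 : Integrable (fun ξ => ‖F (ξ - v) - F ξ‖ ^ 2) (volume : Measure Plane) :=
    (hFv.sub hF).integrable_norm_pow two_ne_zero
  have e1 : ∫ ξ in strip e k, ‖F ξ‖ ^ 2 = ∫ ξ in strip e 0, ‖F (ξ - v)‖ ^ 2 := by
    rw [← integral_indicator (measurableSet_strip e k), ← integral_indicator (measurableSet_strip e 0),
      ← integral_sub_right_eq_self _ v]
    congr 1
    ext ξ
    have : ξ - v ∈ strip e k ↔ ξ ∈ strip e 0 := by
      simp only [strip, Set.mem_ofPred_eq, hv, inner_sub_left, inner_smul_left,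
        real_inner_self_eq_norm_sq, he]
      simp
      constructor
      · rintro ⟨h1, h2⟩
        constructor <;> linarith
      · rintro ⟨h1, h2⟩
        constructor <;> linarith
    by_cases h : ξ ∈ strip e 0
    · rw [Set.indicator_of_mem h, Set.indicator_of_mem (this.mpr h)]
    · rw [Set.indicator_of_notMem h, Set.indicator_of_notMem (fun h' => h (this.mp h'))]
  have e2 : ∫ ξ in strip e 0, ‖F (ξ - v) - F ξ‖ ^ 2 ≤ ∫ ξ, ‖F (ξ - v) - F ξ‖ ^ 2 :=
    setIntegral_le_integral i3 (Filter.Eventually.of_forall fun x => by positivity)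
  have e3 : ∫ ξ in strip e 0, ‖F ξ‖ ^ 2 ≤
      ∫ ξ in strip e 0, (2 * ‖F (ξ - v)‖ ^ 2 + 2 * ‖F (ξ - v) - F ξ‖ ^ 2) := by
    apply integral_mono i1.integrableOn ((i2.const_mul 2).add (i3.const_mul 2)).integrableOn
    intro ξ
    have h := norm_sub_norm_le (F ξ) (F (ξ - v))
    rw [norm_sub_rev] at h
    change ‖F ξ‖ ^ 2 ≤ 2 * ‖F (ξ - v)‖ ^ 2 + 2 * ‖F (ξ - v) - F ξ‖ ^ 2
    nlinarith [norm_nonneg (F ξ), norm_nonneg (F (ξ - v)), norm_nonneg (F (ξ - v) - F ξ),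
      sq_nonneg (‖F (ξ - v)‖ - ‖F (ξ - v) - F ξ‖)]
  rw [integral_add (i2.const_mul 2).integrableOn (i3.const_mul 2).integrableOn,
    integral_const_mul, integral_const_mul] at e3
  rw [e1]
  linarith

lemma strip_bound {δ : ℝ} (e : Plane) (he : ‖e‖ = 1) {f : Plane → ℂ} (hδ : 0 < δ) (hδ1 : δ < 1)
    (hf1 : Integrable f (volume : Measure Plane))
    (hf : MemLp f 2 (volume : Measure Plane)) (hs : Function.support f ⊆ Metric.ball (0 : Plane) δ) :
    ∫ ξ in strip e 0, ‖𝓕 f ξ‖ ^ 2 ≤ 40000 * √δ * ∫ x, ‖f x‖ ^ 2 := by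
  obtain ⟨hF, hE⟩ := memLp_FT hf1 hf
  have i1 : Integrable (fun ξ => ‖𝓕 f ξ‖ ^ 2) (volume : Measure Plane) :=
    hF.integrable_norm_pow two_ne_zero
  set E := ∫ x, ‖f x‖ ^ 2 with hEdef
  have hE0 : 0 ≤ E := integral_nonneg fun x => by positivity
  set M := ∫ ξ in strip e 0, ‖𝓕 f ξ‖ ^ 2 with hM
  set s := √δ with hsdef
  have hs0 : 0 < s := Real.sqrt_pos.mpr hδ
  have hs2 : s ^ 2 = δ := Real.sq_sqrt hδ.le
  have hs1 : s < 1 := by nlinarith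
  set N := ⌈1 / s⌉₊ with hN
  have hN1 : 1 / s ≤ N := Nat.le_ceil _
  have hN2 : (N : ℝ) < 1 / s + 1 := Nat.ceil_lt_add_one (by positivity)
  have hNs1 : 1 ≤ N * s := by rwa [div_le_iff₀ hs0] at hN1
  have hNs2 : N * s ≤ 2 := by
    have : (N : ℝ) * s < (1 / s + 1) * s := by gcongr
    rw [add_mul, div_mul_cancel₀ _ hs0.ne'] at this
    linarith
  have step : ∀ k ∈ Finset.range N, M ≤ 2 * (∫ ξ in strip e k, ‖𝓕 f ξ‖ ^ 2) +
      2 * ((20 * π * N * δ) ^ 2 * E) := by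
    intro k hk
    have hkN : (k : ℝ) ≤ N := by exact_mod_cast (Finset.mem_range.mp hk).le
    have h1 := strip_shift e he k hF
    have h2 := shift_bound ((-(10 * (k:ℝ))) • e) hδ hf1 hf hs
    have h3 : (2 * π * ‖(-(10 * (k:ℝ))) • e‖ * δ) ^ 2 ≤ (20 * π * N * δ) ^ 2 := by
      rw [norm_smul, he, norm_neg, Real.norm_of_nonneg (by positivity), mul_one]
      have : 2 * π * (10 * (k:ℝ)) * δ = 20 * π * k * δ := by ring
      rw [this]
      gcongr
    have h4 := mul_le_mul_of_nonneg_right h3 hE0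
    linarith
  have hsum := Finset.sum_le_sum step
  rw [Finset.sum_add_distrib, ← Finset.mul_sum,
    ← integral_biUnion_finset (Finset.range N) (fun i _ => measurableSet_strip e i)
      (fun i _ j _ hij => strip_disjoint e hij) (fun i _ => i1.integrableOn)] at hsum
  have hU := setIntegral_le_integral (s := ⋃ i ∈ Finset.range N, strip e i) i1
    (Filter.Eventually.of_forall fun x => by positivity)
  rw [hE] at hU
  simp only [Finset.sum_const, Finset.card_range, nsmul_eq_mul] at hsum
  have hπ : π ^ 2 ≤ 10 := by nlinarith [Real.pi_lt_d2, Real.pi_pos]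
  have h5 : (20 * π * N * δ) ^ 2 ≤ 16000 * s := by
    have : (20 * π * N * δ) ^ 2 = 400 * π ^ 2 * (N * s) ^ 2 * s ^ 2 := by rw [← hs2]; ring
    rw [this]
    have a1 : (N * s) ^ 2 ≤ 2 ^ 2 := by gcongr
    have a2 : s ^ 2 ≤ s := by nlinarith
    calc 400 * π ^ 2 * (N * s) ^ 2 * s ^ 2 ≤ 400 * 10 * 2 ^ 2 * s := by gcongr
      _ = 16000 * s := by ring
  have hN0 : (0:ℝ) < N := lt_of_lt_of_le (by positivity) hN1
  have h6 : (N : ℝ) * M ≤ N * (40000 * s * E) := by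
    calc (N : ℝ) * M ≤ 2 * E + N * (2 * ((20 * π * N * δ) ^ 2 * E)) := by linarith
      _ ≤ 2 * E * (N * s) + N * (2 * (16000 * s * E)) := by
        have a1 : 2 * E * 1 ≤ 2 * E * (N * s) := by gcongr
        have a2 : N * (2 * ((20 * π * N * δ) ^ 2 * E)) ≤ N * (2 * (16000 * s * E)) := by gcongr
        linarith
      _ = N * (32002 * s * E) := by ring
      _ ≤ N * (40000 * s * E) := by gcongr; norm_num
  exact le_of_mul_le_mul_left h6 hN0

lemma measurableSet_sector (α β : ℝ) : MeasurableSet (sector α β) := by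
  have hm : ∀ θ : ℝ, Measurable (fun x : Plane => x 0 * Real.cos θ + x 1 * Real.sin θ) :=
    fun θ => Continuous.measurable (by fun_prop)
  exact (measurableSet_le measurable_const (hm β)).inter (measurableSet_lt (hm α) measurable_const)

lemma inner_dir (x : Plane) (θ : ℝ) :
    inner ℝ x (!₂[Real.cos θ, Real.sin θ] : Plane) = x 0 * Real.cos θ + x 1 * Real.sin θ := by
  simp [PiLp.inner_apply, Fin.sum_univ_two, mul_comm]

lemma norm_dir (θ : ℝ) : ‖(!₂[Real.cos θ, Real.sin θ] : Plane)‖ = 1 := by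
  simp [EuclideanSpace.norm_eq, Fin.sum_univ_two]

lemma mem_strip_of {θ : ℝ} {ξ v : Plane} (hv : ‖v‖ ≤ 4)
    (h : ¬ (0 ≤ ξ 0 * Real.cos θ + ξ 1 * Real.sin θ ↔
      0 ≤ (ξ - v) 0 * Real.cos θ + (ξ - v) 1 * Real.sin θ)) :
    ξ ∈ strip !₂[Real.cos θ, Real.sin θ] 0 := by
  rw [← inner_dir, ← inner_dir, inner_sub_left] at h
  have h1 : |inner ℝ v (!₂[Real.cos θ, Real.sin θ] : Plane)| ≤ 4 := by
    refine (abs_real_inner_le_norm _ _).trans ?_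
    rw [norm_dir, mul_one]
    exact hv
  obtain ⟨h2, h3⟩ := abs_le.mp h1
  have h4 : ¬ (ξ ∉ strip !₂[Real.cos θ, Real.sin θ] 0) := by
    intro hn
    apply h
    simp only [strip, Set.mem_ofPred_eq, not_and_or, not_le, not_lt] at hn
    push_cast at hn
    rcases hn with hn | hn
    · constructor <;> intro <;> linarith
    · constructor <;> intro <;> linarith
  exact not_not.mp h4

lemma sector_diff (α β : ℝ) {ξ v : Plane} (hv : ‖v‖ ≤ 4)
    (h1 : ξ ∉ strip !₂[Real.cos α, Real.sin α] 0) (h2 : ξ ∉ strip !₂[Real.cos β, Real.sin β] 0) :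
    ξ - v ∈ sector α β ↔ ξ ∈ sector α β := by
  have a := not_not.mp (fun h => h1 (mem_strip_of hv h))
  have b := not_not.mp (fun h => h2 (mem_strip_of hv h))
  simp only [sector, Set.mem_ofPred_eq, ← not_le]
  rw [a, b]

lemma main_shift {δ : ℝ} (α β : ℝ) (v : Plane) (hv : ‖v‖ ≤ 4) {f : Plane → ℂ} (hδ : 0 < δ)
    (hδ1 : δ < 1)
    (hf1 : Integrable f (volume : Measure Plane))
    (hf : MemLp f 2 (volume : Measure Plane)) (hs : Function.support f ⊆ Metric.ball (0 : Plane) δ)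
    {u : Plane → ℂ} (hu : u = fun ξ => Set.indicator (sector α β) (fun _ => 1) ξ * 𝓕 f ξ) :
    ∫ ξ, ‖u (ξ - v) - u ξ‖ ^ 2 ≤ 200000 * √δ * ∫ x, ‖f x‖ ^ 2 := by
  obtain ⟨hF, hE⟩ := memLp_FT hf1 hf
  have i1 : Integrable (fun ξ => ‖𝓕 f ξ‖ ^ 2) (volume : Measure Plane) :=
    hF.integrable_norm_pow two_ne_zero
  have i3 : Integrable (fun ξ => ‖𝓕 f (ξ - v) - 𝓕 f ξ‖ ^ 2) (volume : Measure Plane) :=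
    ((memLp_shift v hF).sub hF).integrable_norm_pow two_ne_zero
  set A := strip !₂[Real.cos α, Real.sin α] 0 with hA
  set B := strip !₂[Real.cos β, Real.sin β] 0 with hB
  have mA : MeasurableSet A := measurableSet_strip _ _
  have mB : MeasurableSet B := measurableSet_strip _ _
  have bA := strip_bound _ (norm_dir α) hδ hδ1 hf1 hf hs
  have bB := strip_bound _ (norm_dir β) hδ hδ1 hf1 hf hs
  have bD := shift_bound v hδ hf1 hf hs
  rw [← hA, ← integral_indicator mA] at bA
  rw [← hB, ← integral_indicator mB] at bB
  have iA := (i1.indicator mA).const_mul 2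
  have iB := (i1.indicator mB).const_mul 2
  have iD := i3.const_mul 2
  have hle : ∫ ξ, ‖u (ξ - v) - u ξ‖ ^ 2 ≤ ∫ ξ, (2 * ‖𝓕 f (ξ - v) - 𝓕 f ξ‖ ^ 2 +
      2 * A.indicator (fun ξ => ‖𝓕 f ξ‖ ^ 2) ξ + 2 * B.indicator (fun ξ => ‖𝓕 f ξ‖ ^ 2) ξ) := by
    apply integral_mono_of_nonneg
    · filter_upwards with x
      positivity
    · exact (iD.add iA).add iB
    · filter_upwards with ξ
      have nA : 0 ≤ A.indicator (fun ξ => ‖𝓕 f ξ‖ ^ 2) ξ :=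
        Set.indicator_nonneg (fun x _ => by positivity) ξ
      have nB : 0 ≤ B.indicator (fun ξ => ‖𝓕 f ξ‖ ^ 2) ξ :=
        Set.indicator_nonneg (fun x _ => by positivity) ξ
      have nD : 0 ≤ ‖𝓕 f (ξ - v) - 𝓕 f ξ‖ ^ 2 := by positivity
      have gen : ξ ∈ A ∨ ξ ∈ B → ‖𝓕 f ξ‖ ^ 2 ≤ A.indicator (fun ξ => ‖𝓕 f ξ‖ ^ 2) ξ
          + B.indicator (fun ξ => ‖𝓕 f ξ‖ ^ 2) ξ := by
        rintro (h | h)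
        · rw [Set.indicator_of_mem h]; linarith
        · rw [Set.indicator_of_mem h]; linarith
      have tri : ‖𝓕 f (ξ - v)‖ ^ 2 ≤ 2 * ‖𝓕 f (ξ - v) - 𝓕 f ξ‖ ^ 2 + 2 * ‖𝓕 f ξ‖ ^ 2 := by
        have h := norm_sub_norm_le (𝓕 f (ξ - v)) (𝓕 f ξ)
        nlinarith [norm_nonneg (𝓕 f ξ), norm_nonneg (𝓕 f (ξ - v)),
          norm_nonneg (𝓕 f (ξ - v) - 𝓕 f ξ),
          sq_nonneg (‖𝓕 f (ξ - v) - 𝓕 f ξ‖ - ‖𝓕 f ξ‖)]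
      by_cases hAB : ξ ∈ A ∨ ξ ∈ B
      · have g := gen hAB
        simp only [hu]
        by_cases m1 : ξ - v ∈ sector α β <;> by_cases m2 : ξ ∈ sector α β
        · rw [Set.indicator_of_mem m1, Set.indicator_of_mem m2, one_mul, one_mul]
          linarith
        · rw [Set.indicator_of_mem m1, Set.indicator_of_notMem m2, one_mul, zero_mul, sub_zero]
          linarith
        · rw [Set.indicator_of_notMem m1, Set.indicator_of_mem m2, one_mul, zero_mul, zero_sub,
            norm_neg]
          have : 0 ≤ ‖𝓕 f ξ‖ ^ 2 := by positivity
          linarith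
        · rw [Set.indicator_of_notMem m1, Set.indicator_of_notMem m2, zero_mul, zero_mul, sub_zero,
            norm_zero]
          have : 0 ≤ ‖𝓕 f ξ‖ ^ 2 := by positivity
          linarith
      · rw [not_or] at hAB
        have hd := sector_diff α β hv hAB.1 hAB.2
        simp only [hu]
        by_cases m2 : ξ ∈ sector α β
        · rw [Set.indicator_of_mem (hd.mpr m2), Set.indicator_of_mem m2, one_mul, one_mul]
          linarith
        · rw [Set.indicator_of_notMem (fun h => m2 (hd.mp h)), Set.indicator_of_notMem m2,
            zero_mul, zero_mul, sub_zero, norm_zero]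
          linarith
  have hsplit : ∫ ξ, (2 * ‖𝓕 f (ξ - v) - 𝓕 f ξ‖ ^ 2 +
      2 * A.indicator (fun ξ => ‖𝓕 f ξ‖ ^ 2) ξ + 2 * B.indicator (fun ξ => ‖𝓕 f ξ‖ ^ 2) ξ) =
      2 * (∫ ξ, ‖𝓕 f (ξ - v) - 𝓕 f ξ‖ ^ 2) + 2 * (∫ ξ, A.indicator (fun ξ => ‖𝓕 f ξ‖ ^ 2) ξ)
      + 2 * ∫ ξ, B.indicator (fun ξ => ‖𝓕 f ξ‖ ^ 2) ξ := by
    have iDA : Integrable (fun ξ => 2 * ‖𝓕 f (ξ - v) - 𝓕 f ξ‖ ^ 2 +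
      2 * A.indicator (fun ξ => ‖𝓕 f ξ‖ ^ 2) ξ) (volume : Measure Plane) := iD.add iA
    rw [integral_add iDA iB, integral_add iD iA, integral_const_mul, integral_const_mul,
      integral_const_mul]
  rw [hsplit] at hle
  set E := ∫ x, ‖f x‖ ^ 2 with hEdef
  have hE0 : 0 ≤ E := integral_nonneg fun x => by positivity
  have hs0 : 0 < √δ := Real.sqrt_pos.mpr hδ
  have hs2 : √δ ^ 2 = δ := Real.sq_sqrt hδ.le
  have hs1 : √δ < 1 := by nlinarith
  have hπ : π ^ 2 ≤ 10 := by nlinarith [Real.pi_lt_d2, Real.pi_pos]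
  have hc : (2 * π * ‖v‖ * δ) ^ 2 ≤ 640 * √δ := by
    have hd : δ ^ 2 ≤ √δ := by nlinarith
    calc (2 * π * ‖v‖ * δ) ^ 2 = 4 * π ^ 2 * ‖v‖ ^ 2 * δ ^ 2 := by ring
      _ ≤ 4 * 10 * 4 ^ 2 * √δ := by gcongr
      _ = 640 * √δ := by ring
  have := mul_le_mul_of_nonneg_right hc hE0
  have hp : 0 ≤ √δ * E := by positivity
  linarith

lemma avg_cos {y : ℝ} (hy : 1 / 4 ≤ |y|) :
    4 ≤ ∫ t in Set.Ioc (0:ℝ) 4, (2 - 2 * Real.cos (2 * π * (t * y))) := by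
  have hy0 : y ≠ 0 := by
    rintro rfl
    norm_num at hy
  have hc : 2 * π * y ≠ 0 := by positivity
  rw [← intervalIntegral.integral_of_le (by norm_num)]
  have e : ∀ t : ℝ, 2 * π * (t * y) = (2 * π * y) * t := fun t => by ring
  simp only [e]
  rw [intervalIntegral.integral_sub (by simp)
    ((by fun_prop : Continuous fun t : ℝ => 2 * Real.cos ((2 * π * y) * t)).intervalIntegrable _ _),
    intervalIntegral.integral_const_mul, intervalIntegral.integral_comp_mul_left _ hc, integral_cos]
  simp only [intervalIntegral.integral_const, smul_eq_mul, mul_zero, Real.sin_zero, sub_zero]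
  have h1 : |(2 * π * y)⁻¹ * Real.sin (2 * π * y * 4)| ≤ 1 := by
    rw [abs_mul, abs_inv, abs_mul, abs_of_pos (by positivity : (0:ℝ) < 2 * π)]
    have h2 : 1 ≤ 2 * π * |y| := by nlinarith [Real.pi_gt_three]
    calc (2 * π * |y|)⁻¹ * |Real.sin (2 * π * y * 4)| ≤ 1 * 1 := by
          gcongr
          · exact inv_le_one_of_one_le₀ h2
          · exact Real.abs_sin_le_one _
      _ = 1 := by norm_num
  have := (abs_le.mp h1).2
  linarith

lemma avg_bound (j : Fin 2) {h : Plane → ℂ} (hh : MemLp h 2 (volume : Measure Plane)) {R : ℝ}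
    (hR : ∀ v : Plane, ‖v‖ ≤ 4 → ∫ x, ‖chr v x - 1‖ ^ 2 * ‖h x‖ ^ 2 ≤ R) :
    Integrable (fun x => (∫ t in Set.Ioc (0:ℝ) 4, (2 - 2 * Real.cos (2 * π * (t * x j)))) * ‖h x‖ ^ 2)
      (volume : Measure Plane) ∧
    ∫ x : Plane, (∫ t in Set.Ioc (0:ℝ) 4, (2 - 2 * Real.cos (2 * π * (t * x j)))) * ‖h x‖ ^ 2
      ≤ 4 * R := by
  have i1 : Integrable (fun ξ => ‖h ξ‖ ^ 2) (volume : Measure Plane) :=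
    hh.integrable_norm_pow two_ne_zero
  have hprod : Integrable (fun p : ℝ × Plane => (2 - 2 * Real.cos (2 * π * (p.1 * p.2 j))) * ‖h p.2‖ ^ 2)
      ((volume.restrict (Set.Ioc (0:ℝ) 4)).prod (volume : Measure Plane)) := by
    have base : Integrable (fun p : ℝ × Plane => ‖h p.2‖ ^ 2)
        ((volume.restrict (Set.Ioc (0:ℝ) 4)).prod (volume : Measure Plane)) := i1.comp_snd _
    refine base.bdd_mul (c := 4) ?_ ?_
    · apply Continuous.aestronglyMeasurable
      fun_prop
    · filter_upwards with p
      rw [Real.norm_eq_abs, abs_le]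
      constructor <;> linarith [Real.neg_one_le_cos (2 * π * (p.1 * p.2 j)),
        Real.cos_le_one (2 * π * (p.1 * p.2 j))]
  constructor
  · have := hprod.integral_prod_right
    simpa only [integral_mul_const] using this
  · simp only [← integral_mul_const]
    rw [← integral_integral_swap hprod]
    have hb : ∀ t ∈ Set.Ioc (0:ℝ) 4,
        ∫ x : Plane, (2 - 2 * Real.cos (2 * π * (t * x j))) * ‖h x‖ ^ 2 ≤ R := by
      intro t ht
      have := hR (t • EuclideanSpace.single j (1:ℝ)) (by
        rw [norm_smul, EuclideanSpace.norm_single, norm_one, mul_one,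
          Real.norm_of_nonneg ht.1.le]
        exact ht.2)
      simpa [norm_chr_sub_one, inner_smul_right, EuclideanSpace.inner_single_right] using this
    calc _ ≤ ∫ t in Set.Ioc (0:ℝ) 4, R := by
          apply setIntegral_mono_on hprod.integral_prod_left (by simp) measurableSet_Ioc hb
      _ = 4 * R := by simp

lemma final_bound {h : Plane → ℂ} (hh : MemLp h 2 (volume : Measure Plane)) {R : ℝ}
    (hR : ∀ v : Plane, ‖v‖ ≤ 4 → ∫ x, ‖chr v x - 1‖ ^ 2 * ‖h x‖ ^ 2 ≤ R) :
    ∫ x, ‖Set.indicator {y : Plane | 1/2 ≤ ‖y‖} h x‖ ^ 2 ≤ 2 * R := by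
  obtain ⟨j0, b0⟩ := avg_bound 0 hh hR
  obtain ⟨j1, b1⟩ := avg_bound 1 hh hR
  have nn : ∀ y : ℝ, 0 ≤ ∫ t in Set.Ioc (0:ℝ) 4, (2 - 2 * Real.cos (2 * π * (t * y))) := by
    intro y
    apply integral_nonneg
    intro t
    have := Real.cos_le_one (2 * π * (t * y))
    change 0 ≤ 2 - 2 * Real.cos (2 * π * (t * y))
    linarith
  have key : ∫ x, 4 * ‖Set.indicator {y : Plane | 1/2 ≤ ‖y‖} h x‖ ^ 2 ≤
      ∫ x : Plane, ((∫ t in Set.Ioc (0:ℝ) 4, (2 - 2 * Real.cos (2 * π * (t * x 0)))) * ‖h x‖ ^ 2 +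
      (∫ t in Set.Ioc (0:ℝ) 4, (2 - 2 * Real.cos (2 * π * (t * x 1)))) * ‖h x‖ ^ 2) := by
    apply integral_mono_of_nonneg
    · filter_upwards with x
      positivity
    · exact j0.add j1
    · filter_upwards with x
      have n0 := mul_nonneg (nn (x 0)) (sq_nonneg ‖h x‖)
      have n1 := mul_nonneg (nn (x 1)) (sq_nonneg ‖h x‖)
      by_cases hx : x ∈ {y : Plane | 1/2 ≤ ‖y‖}
      · rw [Set.indicator_of_mem hx]
        have hx' : 1 / 2 ≤ ‖x‖ := hx
        have hsq : ‖x‖ ^ 2 = x 0 ^ 2 + x 1 ^ 2 := by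
          rw [EuclideanSpace.norm_sq_eq, Fin.sum_univ_two]
          simp
        have hor : 1 / 4 ≤ |x 0| ∨ 1 / 4 ≤ |x 1| := by
          by_contra hcon
          rw [not_or, not_le, not_le] at hcon
          have a0 := sq_lt_sq' (abs_lt.mp hcon.1).1 (abs_lt.mp hcon.1).2
          have a1 := sq_lt_sq' (abs_lt.mp hcon.2).1 (abs_lt.mp hcon.2).2
          nlinarith
        rcases hor with ho | ho
        · have := mul_le_mul_of_nonneg_right (avg_cos ho) (sq_nonneg ‖h x‖)
          linarith
        · have := mul_le_mul_of_nonneg_right (avg_cos ho) (sq_nonneg ‖h x‖)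
          linarith
      · rw [Set.indicator_of_notMem hx]
        simp only [norm_zero]
        linarith
  rw [integral_add j0 j1, integral_const_mul] at key
  linarith

/-- If `0 < δ < 1/16`, `f ∈ L²(ℝ²)` is supported in `B(0,δ)` and `h = T_{S(α,β)} f` is the
sector multiplier operator applied to `f`, then `‖h · 𝟙_{‖x‖ ≥ 1/2}‖₂ ≤ C δ^{1/4} ‖f‖₂`. -/
theorem statement8 :
    ∃ C : ℝ, 0 < C ∧ ∀ (δ α β : ℝ) (f h : Plane → ℂ), 0 < δ → δ < 1/16 →
      MemLp f 2 (volume : Measure Plane) →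
      Function.support f ⊆ Metric.ball (0 : Plane) δ →
      MemLp h 2 (volume : Measure Plane) →
      HasFourierTransform h
        (fun ξ => Set.indicator (sector α β) (fun _ => 1) ξ * 𝓕 f ξ) →
      l2norm2 (Set.indicator {y : Plane | 1/2 ≤ ‖y‖} h) ≤
        C * δ ^ ((1:ℝ)/4) * l2norm2 f := by
  refine ⟨1000, by norm_num, ?_⟩
  intro δ α β f h hδ hδ16 hf hs hh H
  have hf1 : Integrable f (volume : Measure Plane) := by
    have h1 : IntegrableOn f (Metric.ball (0 : Plane) δ) (volume : Measure Plane) := by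
      have : IsFiniteMeasure ((volume : Measure Plane).restrict (Metric.ball (0 : Plane) δ)) :=
        ⟨by rw [Measure.restrict_apply_univ]; exact measure_ball_lt_top⟩
      exact (hf.restrict _).integrable (by norm_num)
    exact (integrableOn_iff_integrable_of_support_subset hs).mp h1
  obtain ⟨hF, hE⟩ := memLp_FT hf1 hf
  set u : Plane → ℂ := fun ξ => Set.indicator (sector α β) (fun _ => 1) ξ * 𝓕 f ξ with hu
  have hu2 : MemLp u 2 (volume : Measure Plane) := by
    have : u = (sector α β).indicator (𝓕 f) := by
      ext ξ
      by_cases hξ : ξ ∈ sector α β <;> simp [hu, hξ]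
    rw [this]
    exact hF.indicator (measurableSet_sector α β)
  have hfin := final_bound hh (R := 200000 * √δ * ∫ x, ‖f x‖ ^ 2) (by
    intro v hv
    rw [← diff_planch v hh hu2 H]
    exact main_shift α β v hv hδ (by linarith) hf1 hf hs hu)
  unfold l2norm2
  have hE0 : 0 ≤ ∫ x, ‖f x‖ ^ 2 := integral_nonneg fun x => by positivity
  have hp : 0 ≤ √δ * ∫ x, ‖f x‖ ^ 2 := by positivity
  have h3 : (1000 * δ ^ ((1:ℝ)/4) * (∫ x, ‖f x‖ ^ 2) ^ ((1:ℝ)/2)) =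
      (1000 ^ 2 * √δ * ∫ x, ‖f x‖ ^ 2) ^ ((1:ℝ)/2) := by
    rw [Real.mul_rpow (by positivity) hE0, Real.mul_rpow (by positivity) (by positivity),
      Real.sqrt_eq_rpow, ← Real.rpow_mul hδ.le, ← Real.sqrt_eq_rpow (1000 ^ 2),
      Real.sqrt_sq (by norm_num)]
    norm_num
  rw [h3]
  apply Real.rpow_le_rpow (integral_nonneg fun x => by positivity) _ (by norm_num)
  linarith
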